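/- If ∑_{n=1}^∞ (ψ(3^n) · 3^n)^γ = ∞, then μ(W*_𝒞(ψ)) = μ(𝒞) = 1, where μ(A) = ℋ^γ(A ∩ 𝒞). -/

import Mathlib

/-!
Setting: `𝔽₃((X⁻¹))`, the field of formal Laurent series over the field `𝔽₃` with `3` elements,
with absolute value `|f| = 3^N` when `f = ∑_{n ≥ -N} a_{-n} X^{-n}` with `a_N ≠ 0`, `|0| = 0`.
We model it as `LaurentSeries (ZMod 3)` in the variable `t = X⁻¹`, so the coefficient
`a_{-n}` of `X^{-n}` is the coefficient of `t^n`, and `|f| = 3^{-ord_t f}`.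
-/

noncomputable section
open scoped ENNReal Classical

instance : Fact (Nat.Prime 3) := ⟨by norm_num⟩

/-- The field with three elements. -/
abbrev F3 := ZMod 3

/-- The field `𝔽₃((X⁻¹))`, modelled as Laurent series in `t = X⁻¹`. -/
abbrev L3 := LaurentSeries F3

/-- The element `X`, i.e. `t⁻¹`. -/
def XL : L3 := HahnSeries.single (-1 : ℤ) 1

/-- The absolute value: `|f| = 3^{-ord_t f}` for `f ≠ 0` and `|0| = 0`. -/
def absv (f : L3) : ℝ := if f = 0 then 0 else (3 : ℝ) ^ (-f.order)

/-- The ball of radius `r` around `x` for the ultrametric `d(x, y) = |x - y|`. -/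
def ball (x : L3) (r : ℝ) : Set L3 := {y | absv (y - x) < r}

/-- The unit ball `𝕀 = {h : |h| < 1}` around `0`. -/
def unitBall : Set L3 := ball 0 1

/-- The Cantor set `𝒞`: elements of `𝕀` all of whose coefficients `a_{-n}` lie in `{0, 2}`. -/
def Cantor : Set L3 :=
  {f | (∀ m : ℤ, m ≤ 0 → f.coeff m = 0) ∧ ∀ m : ℤ, 1 ≤ m → f.coeff m = 0 ∨ f.coeff m = 2}

/-- `γ = log 2 / log 3`. -/
def gam : ℝ := Real.log 2 / Real.log 3

/-- The Hausdorff `f`-measure of `A ⊆ 𝔽₃((X⁻¹))`, as defined in the paper: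
`ℋ^f(A) = lim_{ρ → 0} inf ∑ᵢ f(r(Bᵢ))`, the infimum being over countable covers of `A`
by balls `Bᵢ` with radius `r(Bᵢ) ≤ ρ`.  Every ball has radius `3^k` for some `k ∈ ℤ`;
a ball is recorded as a pair (centre, k).  (The `⨆` over `ρ` is the limit `ρ → 0`, the inner
infimum being antitone in `ρ`.) -/
def hmeas (f : ℝ → ℝ) (A : Set L3) : ℝ≥0∞ :=
  ⨆ (ρ : ℝ) (_ : 0 < ρ),
    ⨅ (S : Set (L3 × ℤ)) (_ : S.Countable)
      (_ : ∀ p ∈ S, (3 : ℝ) ^ p.2 ≤ ρ)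
      (_ : A ⊆ ⋃ p ∈ S, ball p.1 ((3 : ℝ) ^ p.2)),
      ∑' p : S, ENNReal.ofReal (f ((3 : ℝ) ^ (p : L3 × ℤ).2))

/-- The Hausdorff `γ`-measure `ℋ^γ`. -/
def hgamma (A : Set L3) : ℝ≥0∞ := hmeas (fun r => r ^ gam) A

/-- `μ(A) = ℋ^γ(A ∩ 𝒞)`. -/
def mu (A : Set L3) : ℝ≥0∞ := hgamma (A ∩ Cantor)

/-- A dimension function: a continuous, non-decreasing `f : ℝ_{≥0} → ℝ_{≥0}` with `f 0 = 0`. -/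
structure IsDimFun (f : ℝ → ℝ) : Prop where
  mono : MonotoneOn f (Set.Ici 0)
  cont : ContinuousOn f (Set.Ici 0)
  zero : f 0 = 0
  nonneg : ∀ r, 0 ≤ r → 0 ≤ f r

/-- The image of a polynomial `g ∈ 𝔽₃[X]` in `𝔽₃((X⁻¹))`. -/
def toL (g : Polynomial F3) : L3 := Polynomial.aeval XL g

/-- `ℱ(N)`: polynomials over `𝔽₃` of degree `< N`, all of whose coefficients
`a_0, …, a_{N-1}` lie in `{0, 2}`. -/
def Fset (N : ℕ) : Set (Polynomial F3) :=
  {g | g.degree < (N : ℕ) ∧ ∀ k < N, g.coeff k = 0 ∨ g.coeff k = 2}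

/-- `ℱ*(N)`: members of `ℱ(N)` with `g(0) = 2`. -/
def FsetStar (N : ℕ) : Set (Polynomial F3) :=
  {g | g.degree < (N : ℕ) ∧ (∀ k < N, g.coeff k = 0 ∨ g.coeff k = 2) ∧ g.coeff 0 = 2}

/-- `W_𝒞(ψ)`: elements `h ∈ 𝒞` with `|h - g/X^N| < ψ(3^N)` for infinitely many `N ∈ ℕ`,
where `g ∈ ℱ(N)`.  Here `ψ N` stands for `ψ(3^N)`. -/
def Wc (ψ : ℕ → ℝ) : Set L3 :=
  {h ∈ Cantor | ∀ m : ℕ, ∃ N : ℕ, m ≤ N ∧ 1 ≤ N ∧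
    ∃ g ∈ Fset N, absv (h - toL g / XL ^ N) < ψ N}

/-- `W*_𝒞(ψ)`: defined like `W_𝒞(ψ)`, with `ℱ*(N)` in place of `ℱ(N)`. -/
def WcStar (ψ : ℕ → ℝ) : Set L3 :=
  {h ∈ Cantor | ∀ m : ℕ, ∃ N : ℕ, m ≤ N ∧ 1 ≤ N ∧
    ∃ g ∈ FsetStar N, absv (h - toL g / XL ^ N) < ψ N}

/-- `A*_n = ⋃_{g ∈ ℱ*(n)} B(g/Xⁿ, ψ(3ⁿ))`. -/
def Astar (ψ : ℕ → ℝ) (n : ℕ) : Set L3 :=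
  ⋃ g ∈ FsetStar n, ball (toL g / XL ^ n) (ψ n)

/-- `𝒦(ψ)`: elements `ξ ∈ 𝕀` with `|ξ - g/h| < ψ(|h|)` for infinitely many fractions
`g/h ∈ 𝔽₃(X)`.  Here `ψ d` stands for `ψ(3^d)`, and `|h| = 3^{deg h}`. -/
def Kset (ψ : ℕ → ℝ) : Set L3 :=
  {ξ ∈ unitBall | {gh : Polynomial F3 × Polynomial F3 | gh.2 ≠ 0 ∧
    absv (ξ - toL gh.1 / toL gh.2) < ψ gh.2.natDegree}.Infinite}

/-- The irrationality exponent
`τ(ξ) = sup {τ : |ξ - g/h| < |h|^{-τ} for infinitely many g/h ∈ 𝔽₃(X)}`, valued in `[0, ∞]`. -/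
def irrExp (ξ : L3) : ℝ≥0∞ :=
  sSup {t : ℝ≥0∞ | ∃ τ : ℝ, t = ENNReal.ofReal τ ∧
    {gh : Polynomial F3 × Polynomial F3 | gh.2 ≠ 0 ∧
      absv (ξ - toL gh.1 / toL gh.2) < absv (toL gh.2) ^ (-τ)}.Infinite}

open MeasureTheory Filter Topology

/-- The quantitative form of the divergence Borel–Cantelli lemma, obtained from Chebyshev's
inequality: few points avoid all the events `E i`, `i ∈ s`. -/
theorem measureReal_avoid_mul_sq_le {Ω ι : Type*} [MeasurableSpace Ω] {P : Measure Ω}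
    [IsProbabilityMeasure P] {E : ι → Set Ω} (hE : ∀ i, MeasurableSet (E i))
    (hpair : ∀ i j, i ≠ j → P.real (E i ∩ E j) ≤ P.real (E i) * P.real (E j)) (s : Finset ι) :
    P.real {ω | ∀ i ∈ s, ω ∉ E i} * (∑ i ∈ s, P.real (E i)) ^ 2 ≤ ∑ i ∈ s, P.real (E i) := by
  set e := ∑ i ∈ s, P.real (E i) with he
  set S : Ω → ℝ := fun ω => ∑ i ∈ s, (E i).indicator 1 ω with hS
  set T := {ω | ∀ i ∈ s, ω ∉ E i} with hT
  have hTm : MeasurableSet T := by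
    have : T = ⋂ i ∈ s, (E i)ᶜ := by ext; simp [hT]
    rw [this]
    exact Finset.measurableSet_biInter _ fun i _ => (hE i).compl
  have hind : ∀ A : Set Ω, MeasurableSet A → Integrable (A.indicator (1 : Ω → ℝ)) P :=
    fun A hA => (integrable_const (1 : ℝ)).indicator hA
  have hSint : Integrable S P := integrable_finsetSum _ fun i _ => hind _ (hE i)
  have hS2 : (fun ω => S ω ^ 2) =
      fun ω => ∑ i ∈ s, ∑ j ∈ s, (E i ∩ E j).indicator (1 : Ω → ℝ) ω := by
    funext ω
    simp only [hS, sq, Finset.sum_mul_sum, Set.inter_indicator_one, Pi.mul_apply]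
  have hS2int : Integrable (fun ω => S ω ^ 2) P := by
    rw [hS2]
    exact integrable_finsetSum _ fun i _ => integrable_finsetSum _ fun j _ =>
      hind _ ((hE i).inter (hE j))
  have hIS : ∫ ω, S ω ∂P = e := by
    rw [integral_finsetSum _ fun i _ => hind _ (hE i)]
    exact Finset.sum_congr rfl fun i _ => integral_indicator_one (hE i)
  have hIS2 : ∫ ω, S ω ^ 2 ∂P ≤ e ^ 2 + e := by
    rw [hS2, integral_finsetSum _ fun i _ => integrable_finsetSum _ fun j _ =>
      hind _ ((hE i).inter (hE j))]
    have : ∀ i ∈ s, ∫ ω, ∑ j ∈ s, (E i ∩ E j).indicator (1 : Ω → ℝ) ω ∂P ≤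
        P.real (E i) * e + P.real (E i) := by
      intro i hi
      rw [integral_finsetSum _ fun j _ => hind _ ((hE i).inter (hE j))]
      simp_rw [integral_indicator_one ((hE i).inter (hE _))]
      calc ∑ j ∈ s, P.real (E i ∩ E j)
          ≤ ∑ j ∈ s, (P.real (E i) * P.real (E j) + if i = j then P.real (E i) else 0) := by
            refine Finset.sum_le_sum fun j _ => ?_
            split_ifs with h
            · subst h
              rw [Set.inter_self]
              nlinarith [measureReal_nonneg (μ := P) (s := E i)]
            · simpa using hpair i j h
        _ = P.real (E i) * e + P.real (E i) := by
            rw [Finset.sum_add_distrib, ← Finset.mul_sum, Finset.sum_ite_eq, if_pos hi]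
    refine (Finset.sum_le_sum this).trans_eq ?_
    rw [Finset.sum_add_distrib, ← Finset.sum_mul, sq]
  have hle : ∫ ω, T.indicator (fun _ => e ^ 2) ω ∂P ≤ ∫ ω, (S ω ^ 2 - 2 * e * S ω + e ^ 2) ∂P := by
    refine integral_mono ((integrable_const _).indicator hTm)
      ((hS2int.sub (hSint.const_mul _)).add (integrable_const _)) fun ω => ?_
    by_cases hω : ω ∈ T
    · have : S ω = 0 := Finset.sum_eq_zero fun i hi => by simp [hω i hi]
      simp [hω, this]
    · simp only [Set.indicator_of_notMem hω]
      nlinarith [sq_nonneg (S ω - e)]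
  have hexp : ∫ ω, (S ω ^ 2 - 2 * e * S ω + e ^ 2) ∂P = ∫ ω, S ω ^ 2 ∂P - 2 * e * e + e ^ 2 := by
    have hadd := integral_add (f := fun ω => S ω ^ 2 - 2 * e * S ω)
      (hS2int.sub (hSint.const_mul (2 * e))) (integrable_const (μ := P) (e ^ 2))
    have hsub := integral_sub hS2int (hSint.const_mul (2 * e))
    rw [hadd, hsub, integral_const_mul, hIS]
    simp
  rw [integral_indicator_const _ hTm, hexp, smul_eq_mul] at hle
  linarith

/-- The divergence Borel–Cantelli lemma for pairwise negatively correlated events. -/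
theorem ae_frequently_mem_of_not_summable {Ω : Type*} [MeasurableSpace Ω] {P : Measure Ω}
    [IsProbabilityMeasure P] {E : ℕ → Set Ω} (hE : ∀ i, MeasurableSet (E i))
    (hpair : ∀ i j, i ≠ j → P.real (E i ∩ E j) ≤ P.real (E i) * P.real (E j))
    (hsum : ¬ Summable fun i => P.real (E i)) :
    ∀ᵐ ω ∂P, ∀ m, ∃ n, m ≤ n ∧ ω ∈ E n := by
  rw [ae_all_iff]
  intro m
  have htend : Tendsto (fun n => ∑ i ∈ Finset.range n, P.real (E (i + m))) atTop atTop :=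
    (not_summable_iff_tendsto_nat_atTop_of_nonneg fun _ => measureReal_nonneg).1
      (mt (summable_nat_add_iff (f := fun i => P.real (E i)) m).1 hsum)
  have hbound : ∀ᶠ n in atTop, P.real {ω | ∀ i, ω ∉ E (i + m)} ≤
      (∑ i ∈ Finset.range n, P.real (E (i + m)))⁻¹ := by
    filter_upwards [htend.eventually_gt_atTop 0] with n hn
    have h := measureReal_avoid_mul_sq_le (fun i => hE (i + m))
      (fun i j hij => hpair (i + m) (j + m) (by omega)) (Finset.range n)
    have hmono : P.real {ω | ∀ i, ω ∉ E (i + m)} ≤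
        P.real {ω | ∀ i ∈ Finset.range n, ω ∉ E (i + m)} :=
      measureReal_mono fun ω hω i _ => hω i
    refine hmono.trans ?_
    rw [← one_div, le_div_iff₀ hn]
    exact le_of_mul_le_mul_right (by linarith) hn
  have hzero : P.real {ω | ∀ i, ω ∉ E (i + m)} = 0 :=
    le_antisymm (ge_of_tendsto htend.inv_tendsto_atTop hbound) measureReal_nonneg
  rw [measureReal_eq_zero_iff] at hzero
  refine measure_mono_null (fun ω hω i hi => hω ⟨i + m, by omega, hi⟩) hzero

/-- The law of a sequence of independent fair coin tosses. -/
def coinMeasure : Measure (ℕ → Bool) :=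
  Measure.infinitePi fun _ => (PMF.uniformOfFintype Bool).toMeasure

instance : IsProbabilityMeasure coinMeasure := by
  unfold coinMeasure
  infer_instance

/-- The cylinder of sequences agreeing with `b` on `s`. -/
def boolCylinder (s : Finset ℕ) (b : ℕ → Bool) : Set (ℕ → Bool) := {ω | ∀ i ∈ s, ω i = b i}

theorem boolCylinder_eq_pi (s : Finset ℕ) (b : ℕ → Bool) :
    boolCylinder s b = Set.pi s fun i => {b i} := by
  ext
  simp [boolCylinder, Set.mem_pi]

theorem measurableSet_boolCylinder (s : Finset ℕ) (b : ℕ → Bool) :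
    MeasurableSet (boolCylinder s b) := by
  rw [boolCylinder_eq_pi]
  exact MeasurableSet.pi s.countable_toSet fun _ _ => measurableSet_singleton _

theorem coinMeasure_boolCylinder (s : Finset ℕ) (b : ℕ → Bool) :
    coinMeasure (boolCylinder s b) = 2⁻¹ ^ s.card := by
  rw [boolCylinder_eq_pi, coinMeasure, Measure.infinitePi_pi _ fun _ _ => measurableSet_singleton _]
  simp

theorem coinMeasure_real_boolCylinder (s : Finset ℕ) (b : ℕ → Bool) :
    coinMeasure.real (boolCylinder s b) = 2⁻¹ ^ s.card := by
  simp [Measure.real, coinMeasure_boolCylinder]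

/-- The event that a digit `1` in position `N` is followed by zeros up to position `r`; it is the
full space when `r < N`. -/
def digitEvent (N r : ℕ) : Set (ℕ → Bool) :=
  boolCylinder (Finset.Icc N r) fun i => decide (i = N)

theorem digitEvent_negatively_correlated_of_lt {N M : ℕ} (h : N < M) (r q : ℕ) :
    coinMeasure.real (digitEvent N r ∩ digitEvent M q) ≤
      coinMeasure.real (digitEvent N r) * coinMeasure.real (digitEvent M q) := by
  by_cases hd : Disjoint (Finset.Icc N r) (Finset.Icc M q)
  · have : digitEvent N r ∩ digitEvent M q =
        boolCylinder (Finset.Icc N r ∪ Finset.Icc M q)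
          fun i => if i ∈ Finset.Icc N r then decide (i = N) else decide (i = M) := by
      ext ω
      constructor
      · rintro ⟨h₁, h₂⟩ i hi
        dsimp only
        split_ifs with hi'
        · exact h₁ i hi'
        · exact h₂ i ((Finset.mem_union.1 hi).resolve_left hi')
      · intro hω
        refine ⟨fun i hi => ?_, fun i hi => ?_⟩
        · simpa only [if_pos hi] using hω i (Finset.mem_union_left _ hi)
        · simpa only [if_neg (Finset.disjoint_right.1 hd hi)] using
            hω i (Finset.mem_union_right _ hi)
    rw [this, digitEvent, digitEvent]
    simp only [coinMeasure_real_boolCylinder, Finset.card_union_of_disjoint hd, pow_add, le_refl]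
  · have : digitEvent N r ∩ digitEvent M q = ∅ := by
      rw [Finset.not_disjoint_iff] at hd
      obtain ⟨i, hi, hi'⟩ := hd
      rw [Finset.mem_Icc] at hi hi'
      refine Set.eq_empty_of_forall_notMem fun ω hω => ?_
      have h₁ := hω.1 M (Finset.mem_Icc.2 ⟨h.le, hi'.1.trans hi.2⟩)
      have h₂ := hω.2 M (Finset.mem_Icc.2 ⟨le_rfl, hi'.1.trans hi'.2⟩)
      simp [h₁, h.ne'] at h₂
    rw [this, measureReal_empty]
    positivity

theorem digitEvent_negatively_correlated {N M : ℕ} (h : N ≠ M) (r q : ℕ) :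
    coinMeasure.real (digitEvent N r ∩ digitEvent M q) ≤
      coinMeasure.real (digitEvent N r) * coinMeasure.real (digitEvent M q) := by
  rcases h.lt_or_gt with h | h
  · exact digitEvent_negatively_correlated_of_lt h r q
  · rw [Set.inter_comm, mul_comm]
    exact digitEvent_negatively_correlated_of_lt h q r

theorem absv_lt_zpow_iff (f : L3) (k : ℤ) :
    absv f < (3 : ℝ) ^ k ↔ ∀ m : ℤ, m ≤ -k → f.coeff m = 0 := by
  unfold absv
  split_ifs with hf
  · subst hf
    simp only [HahnSeries.coeff_zero, implies_true, iff_true]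
    positivity
  · rw [zpow_lt_zpow_iff_right₀ (by norm_num)]
    constructor
    · intro h m hm
      exact HahnSeries.coeff_eq_zero_of_lt_order (by linarith)
    · intro h
      by_contra hk
      exact hf (HahnSeries.coeff_order_eq_zero.1 (h _ (by linarith)))

theorem mem_ball_zpow_iff (x y : L3) (k : ℤ) :
    y ∈ ball x ((3 : ℝ) ^ k) ↔ ∀ m : ℤ, m ≤ -k → y.coeff m = x.coeff m := by
  simp only [ball, Set.mem_ofPred_eq, absv_lt_zpow_iff, HahnSeries.coeff_sub, sub_eq_zero]

theorem coeff_toL (g : Polynomial F3) (m : ℤ) :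
    (toL g).coeff m = if m ≤ 0 then g.coeff (-m).toNat else 0 := by
  induction g using Polynomial.induction_on' with
  | add p q hp hq =>
    have : toL (p + q) = toL p + toL q := map_add _ _ _
    rw [this, HahnSeries.coeff_add, hp, hq]
    split_ifs <;> simp
  | monomial n a =>
    have : toL (Polynomial.monomial n a) = HahnSeries.single (-(n : ℤ)) a := by
      rw [toL, Polynomial.aeval_monomial, XL, HahnSeries.single_pow,
        Subsingleton.elim (algebraMap F3 L3) HahnSeries.C]
      simp [HahnSeries.C_apply]
    rw [this, HahnSeries.coeff_single, Polynomial.coeff_monomial]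
    split_ifs <;> first | rfl | omega

theorem coeff_toL_div (g : Polynomial F3) (N : ℕ) (m : ℤ) :
    (toL g / XL ^ N).coeff m = if m ≤ N then g.coeff (N - m).toNat else 0 := by
  have : (XL ^ N)⁻¹ = HahnSeries.single (N : ℤ) (1 : F3) := by
    rw [XL, HahnSeries.single_pow, HahnSeries.inv_single]
    simp
  rw [div_eq_mul_inv, this, HahnSeries.coeff_mul_single, coeff_toL, mul_one]
  simp

/-- The point of the Cantor set whose `n`-th digit is `2` exactly when `ω n` holds, `n ≥ 1`. -/
def cantorPoint (ω : ℕ → Bool) : L3 :=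
  HahnSeries.ofSuppBddBelow (fun m : ℤ => if 1 ≤ m ∧ ω m.toNat = true then 2 else 0)
    ⟨1, fun m hm => by
      by_contra h
      exact hm (if_neg fun h' => h h'.1)⟩

theorem coeff_cantorPoint (ω : ℕ → Bool) (m : ℤ) :
    (cantorPoint ω).coeff m = if 1 ≤ m ∧ ω m.toNat = true then 2 else 0 := rfl

theorem cantorPoint_mem (ω : ℕ → Bool) : cantorPoint ω ∈ Cantor := by
  refine ⟨fun m hm => ?_, fun m _ => ?_⟩
  · rw [coeff_cantorPoint, if_neg (by omega)]
  · rw [coeff_cantorPoint]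
    split_ifs <;> simp

theorem F3_two_ne_zero : (2 : F3) ≠ 0 := by decide

theorem coeff_cantorPoint_eq_iff (ω ω' : ℕ → Bool) {n : ℕ} (hn : 1 ≤ n) :
    (cantorPoint ω).coeff n = (cantorPoint ω').coeff n ↔ ω n = ω' n := by
  have : (1 : ℤ) ≤ n := by exact_mod_cast hn
  rw [coeff_cantorPoint, coeff_cantorPoint]
  cases h : ω n <;> cases h' : ω' n <;>
    simp [h, h', this, F3_two_ne_zero, F3_two_ne_zero.symm, -Nat.one_le_cast]

theorem zpow_three_rpow_gam (k : ℤ) : ((3 : ℝ) ^ k) ^ gam = 2 ^ k := by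
  have h3 : (3 : ℝ) ^ gam = 2 := by
    rw [gam, Real.rpow_def_of_pos (by norm_num), mul_div_cancel₀, Real.exp_log (by norm_num)]
    exact (Real.log_pos (by norm_num)).ne'
  rw [← Real.rpow_intCast, ← Real.rpow_mul (by norm_num), mul_comm, Real.rpow_mul (by norm_num),
    h3, Real.rpow_intCast]

theorem ofReal_two_zpow_neg (n : ℕ) : ENNReal.ofReal ((2 : ℝ) ^ (-(n : ℤ))) = 2⁻¹ ^ n := by
  rw [zpow_neg, zpow_natCast, ← inv_pow, ENNReal.ofReal_pow (by norm_num),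
    ENNReal.ofReal_inv_of_pos (by norm_num), ENNReal.ofReal_ofNat]

theorem coinMeasure_preimage_ball_le (x : L3) {k : ℤ} (hk : k ≤ 0) :
    coinMeasure (cantorPoint ⁻¹' ball x ((3 : ℝ) ^ k)) ≤
      ENNReal.ofReal (((3 : ℝ) ^ k) ^ gam) := by
  obtain ⟨n, rfl⟩ : ∃ n : ℕ, k = -n := ⟨(-k).toNat, by omega⟩
  rcases Set.eq_empty_or_nonempty (cantorPoint ⁻¹' ball x ((3 : ℝ) ^ (-(n : ℤ)))) with h | ⟨ω', hω'⟩
  · rw [h, measure_empty]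
    exact zero_le
  · have hsub : cantorPoint ⁻¹' ball x ((3 : ℝ) ^ (-(n : ℤ))) ⊆
        boolCylinder (Finset.Icc 1 n) ω' := by
      intro ω hω i hi
      rw [Finset.mem_Icc] at hi
      rw [Set.mem_preimage, mem_ball_zpow_iff] at hω hω'
      rw [← coeff_cantorPoint_eq_iff ω ω' hi.1, hω i (by omega), hω' i (by omega)]
    refine (measure_mono hsub).trans ?_
    rw [coinMeasure_boolCylinder, zpow_three_rpow_gam, ofReal_two_zpow_neg]
    simp

/-- Mass distribution: the Hausdorff measure dominates the coin tossing measure. -/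
theorem coinMeasure_preimage_le_hgamma (A : Set L3) :
    coinMeasure (cantorPoint ⁻¹' A) ≤ hgamma A := by
  refine le_trans ?_ (le_iSup₂ (1 : ℝ) one_pos)
  refine le_iInf fun S => le_iInf fun hS => le_iInf fun hr => le_iInf fun hA => ?_
  calc coinMeasure (cantorPoint ⁻¹' A)
      ≤ coinMeasure (⋃ p ∈ S, cantorPoint ⁻¹' ball p.1 ((3 : ℝ) ^ p.2)) := by
        refine measure_mono ?_
        rw [← Set.preimage_iUnion₂]
        exact Set.preimage_mono hA
    _ ≤ ∑' p : S, coinMeasure (cantorPoint ⁻¹' ball (p : L3 × ℤ).1 ((3 : ℝ) ^ (p : L3 × ℤ).2)) :=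
        measure_biUnion_le _ hS _
    _ ≤ _ := by
        refine ENNReal.tsum_le_tsum fun p => coinMeasure_preimage_ball_le _ ?_
        have h := hr p p.2
        rw [← zpow_zero (3 : ℝ)] at h
        exact (zpow_le_zpow_iff_right₀ (by norm_num)).1 h

theorem hgamma_mono {A B : Set L3} (h : A ⊆ B) : hgamma A ≤ hgamma B :=
  iSup₂_mono fun _ _ => iInf_mono fun _ => iInf_mono fun _ => iInf_mono fun _ =>
    iInf_mono' fun hB => ⟨h.trans hB, le_rfl⟩

theorem hgamma_Cantor_le_one : hgamma Cantor ≤ 1 := by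
  refine iSup₂_le fun ρ hρ => ?_
  obtain ⟨n, hn⟩ := exists_pow_lt_of_lt_one hρ (show (3 : ℝ)⁻¹ < 1 by norm_num)
  set T : Finset (L3 × ℤ) := (Finset.Icc 1 n).powerset.image
    fun s => (cantorPoint fun i => decide (i ∈ s), -(n : ℤ)) with hT
  have hT2 : ∀ p ∈ T, p.2 = -(n : ℤ) := by
    intro p hp
    obtain ⟨s, -, rfl⟩ := Finset.mem_image.1 hp
    rfl
  have hcover : Cantor ⊆ ⋃ p ∈ (T : Set (L3 × ℤ)), ball p.1 ((3 : ℝ) ^ p.2) := by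
    intro f hf
    refine Set.mem_biUnion (Finset.mem_coe.2 (Finset.mem_image_of_mem _ (Finset.mem_powerset.2
      (Finset.filter_subset (fun i : ℕ => f.coeff i = 2) (Finset.Icc 1 n))))) ?_
    rw [mem_ball_zpow_iff]
    intro m hm
    rw [coeff_cantorPoint]
    rcases le_or_gt m 0 with h0 | h0
    · rw [hf.1 m h0, if_neg (by omega)]
    · obtain ⟨i, rfl⟩ : ∃ i : ℕ, m = i := ⟨m.toNat, by omega⟩
      have hi : 1 ≤ i ∧ i ≤ n := by omega
      have hi' : (1 : ℤ) ≤ i := by omega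
      rcases hf.2 i hi' with h | h <;>
        simp [h, hi, hi', F3_two_ne_zero.symm, -Nat.one_le_cast]
  refine (iInf₂_le (T : Set (L3 × ℤ)) T.countable_toSet).trans ((iInf₂_le ?_ hcover).trans ?_)
  · intro p hp
    rw [hT2 p hp, zpow_neg, zpow_natCast, ← inv_pow]
    exact hn.le
  · rw [Finset.tsum_subtype' T fun p => ENNReal.ofReal (((3 : ℝ) ^ p.2) ^ gam)]
    rw [Finset.sum_congr rfl fun p hp => by
      rw [hT2 p hp, zpow_three_rpow_gam, ofReal_two_zpow_neg], Finset.sum_const, nsmul_eq_mul]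
    have hcard : (T.card : ℝ≥0∞) ≤ 2 ^ n := by
      have : T.card ≤ 2 ^ n := by
        simpa using Finset.card_image_le (s := (Finset.Icc 1 n).powerset)
          (f := fun s => ((cantorPoint fun i => decide (i ∈ s), -(n : ℤ)) : L3 × ℤ))
      exact_mod_cast this
    calc (T.card : ℝ≥0∞) * 2⁻¹ ^ n ≤ 2 ^ n * 2⁻¹ ^ n := by gcongr
      _ = 1 := by
        rw [← mul_pow, ENNReal.mul_inv_cancel (by norm_num) (by norm_num), one_pow]

theorem mu_Cantor : mu Cantor = 1 := by
  rw [mu, Set.inter_self]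
  refine le_antisymm hgamma_Cantor_le_one ?_
  have h := coinMeasure_preimage_le_hgamma Cantor
  have huniv : cantorPoint ⁻¹' Cantor = Set.univ := Set.eq_univ_of_forall cantorPoint_mem
  rwa [huniv, measure_univ] at h

theorem exists_approximant_of_mem_digitEvent {ω : ℕ → Bool} {N : ℕ} (hN : 1 ≤ N) (r : ℤ)
    (hω : ω ∈ digitEvent N r.toNat) :
    ∃ g ∈ FsetStar N, absv (cantorPoint ω - toL g / XL ^ N) < (3 : ℝ) ^ (-r) := by
  set c : ℕ → F3 := fun k => if k = 0 ∨ ω (N - k) = true then 2 else 0 with hc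
  set g : Polynomial F3 := ∑ k ∈ Finset.range N, Polynomial.monomial k (c k) with hg
  have hcoeff : ∀ k, g.coeff k = if k < N then c k else 0 := by
    intro k
    simp [hg, Polynomial.coeff_monomial]
  refine ⟨g, ⟨?_, ?_, ?_⟩, ?_⟩
  · rw [Polynomial.degree_lt_iff_coeff_zero]
    intro k hk
    rw [hcoeff, if_neg (by omega)]
  · intro k hk
    rw [hcoeff, if_pos hk, hc]
    dsimp only
    split_ifs <;> simp
  · rw [hcoeff, if_pos (by omega), hc]
    simp
  · rw [absv_lt_zpow_iff, neg_neg]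
    intro m hm
    rw [HahnSeries.coeff_sub, sub_eq_zero, coeff_cantorPoint, coeff_toL_div]
    rcases le_or_gt m 0 with h0 | h0
    · rw [if_neg (by omega), hcoeff, if_neg (by omega : ¬ ((N : ℤ) - m).toNat < N), ite_self]
    · obtain ⟨i, rfl⟩ : ∃ i : ℕ, m = i := ⟨m.toNat, by omega⟩
      have hi' : (1 : ℤ) ≤ i := by omega
      rcases lt_or_ge i N with h | h
      · have h1 : ((N : ℤ) - i).toNat = N - i := by omega
        rw [if_pos (show (i : ℤ) ≤ N by omega), h1, hcoeff,
          if_pos (by omega : N - i < N), hc]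
        have h2 : N - (N - i) = i := by omega
        have h3 : N - i ≠ 0 := by omega
        simp only [hi', true_and, Int.toNat_natCast, h2, h3, false_or]
      · have hval := hω i (Finset.mem_Icc.2 ⟨h, by omega⟩)
        rcases h.eq_or_lt with rfl | h
        · simp [hcoeff, hc, hval, hN, Nat.one_le_iff_ne_zero.1 hN]
        · rw [if_neg (by simp [hval, h.ne']), if_neg (by omega)]

theorem not_summable_digitEvent {ψ : ℕ → ℝ} {r : ℕ → ℤ}
    (hr : ∀ n, ψ (n + 1) = (3 : ℝ) ^ (-(r n)))
    (hdiv : ∑' n : ℕ, ENNReal.ofReal ((ψ (n + 1) * (3 : ℝ) ^ (n + 1)) ^ gam) = ⊤) :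
    ¬ Summable fun n => coinMeasure.real (digitEvent (n + 1) (r n).toNat) := by
  intro hs
  refine absurd hdiv (Summable.tsum_ofReal_ne_top ?_)
  refine (hs.mul_left 2).of_norm_bounded_eventually_nat ?_
  filter_upwards [hs.tendsto_atTop_zero.eventually_lt_const one_pos] with n hn
  rw [digitEvent, coinMeasure_real_boolCylinder, Nat.card_Icc] at hn ⊢
  have hlt : n + 1 ≤ (r n).toNat := by
    by_contra h
    rw [show (r n).toNat + 1 - (n + 1) = 0 by omega] at hn
    simp at hn
  obtain ⟨d, hd⟩ : ∃ d : ℕ, r n = n + 1 + d := ⟨(r n).toNat - (n + 1), by omega⟩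
  have hpow : (3 : ℝ) ^ (-(r n)) * 3 ^ (n + 1) = 3 ^ (-(d : ℤ)) := by
    rw [← zpow_natCast, ← zpow_add₀ (by norm_num), hd]
    congr 1
    push_cast
    ring
  rw [hr, hpow, zpow_three_rpow_gam, show (r n).toNat + 1 - (n + 1) = d + 1 by omega, zpow_neg,
    zpow_natCast, Real.norm_of_nonneg (by positivity), pow_succ, inv_pow]
  linarith

/-- If `∑_{n ≥ 1} (ψ(3^n) · 3^n)^γ = ∞` then
`μ(W*_𝒞(ψ)) = μ(𝒞) = 1`, where `μ(A) = ℋ^γ(A ∩ 𝒞)`. -/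
theorem mu_WcStar_of_divergent (ψ : ℕ → ℝ)
    (hψ : ∀ n : ℕ, 1 ≤ n → ∃ r : ℤ, ψ n = (3 : ℝ) ^ (-r))
    (hdiv : ∑' n : ℕ, ENNReal.ofReal ((ψ (n + 1) * (3 : ℝ) ^ (n + 1)) ^ gam) = ⊤) :
    mu (WcStar ψ) = 1 ∧ mu Cantor = 1 := by
  refine ⟨le_antisymm ?_ ?_, mu_Cantor⟩
  · exact (hgamma_mono Set.inter_subset_right).trans hgamma_Cantor_le_one
  choose r hr using fun n : ℕ => hψ (n + 1) (Nat.le_add_left 1 n)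
  have hae : ∀ᵐ ω ∂coinMeasure, ∀ m, ∃ n, m ≤ n ∧ ω ∈ digitEvent (n + 1) (r n).toNat :=
    ae_frequently_mem_of_not_summable (fun _ => measurableSet_boolCylinder _ _)
      (fun _ _ hij => digitEvent_negatively_correlated (by omega) _ _)
      (not_summable_digitEvent hr hdiv)
  have hfull : ∀ᵐ ω ∂coinMeasure, ω ∈ cantorPoint ⁻¹' (WcStar ψ ∩ Cantor) := by
    filter_upwards [hae] with ω hω
    refine ⟨⟨cantorPoint_mem ω, fun m => ?_⟩, cantorPoint_mem ω⟩
    obtain ⟨n, hmn, hn⟩ := hω m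
    refine ⟨n + 1, by omega, by omega, ?_⟩
    rw [hr n]
    exact exists_approximant_of_mem_digitEvent (by omega) (r n) hn
  rw [← measure_univ (μ := coinMeasure), ← measure_congr (eventuallyEq_univ.2 hfull)]
  exact coinMeasure_preimage_le_hgamma _
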